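/- Let Σ be a finite alphabet partitioned into consonants and vowels, and let σ : Σ* → {0,1}* be the homomorphism with σ(x) = 1 for every consonant x and σ(y) = 0 for every vowel y. Let G be the context-free grammar with nonterminals {S, A, B, X, Y}, terminals Σ ∪ {0, 1, #}, start symbol S, and rules S → A#B; B → 0YB, B → 0Y, B → 1XB, B → 1X; A → aAY and A → aY for every vowel a ∈ Σ; A → bAX and A → bX for every consonant b ∈ Σ. Set W = {X, Y, #} and F = {w#w^R : w ∈ {X,Y}*}. Then L(G,F) = {w#σ(w) : w ∈ Σ⁺}. -/

import Mathlib

/- The weak identity from `V*` to `W*`: keeps symbols of `W`, erases all others. -/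
open scoped Classical in
noncomputable def projOn {α : Type*} (W : Set α) (y : List α) : List α :=
  y.filter (fun a => decide (a ∈ W))

/-- Erase all nonterminals, keeping the terminal string. -/
def projT {T N : Type*} (y : List (Symbol T N)) : List T :=
  y.filterMap (fun s => match s with
    | Symbol.terminal t => some t
    | Symbol.nonterminal _ => none)

/-- The language of a context-free grammar `G` finalized by a final language `F`
over the subalphabet `W` of the total alphabet of `G`:  `L(G,F)` consists of the
terminal strings obtained from sentential forms `y` of `G` such that the projection
of `y` onto `W` belongs to `F` and every symbol of `y` lies in `W ∪ T`. -/
noncomputable def finalizedLanguage {T : Type*} (G : ContextFreeGrammar T)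
    (W : Set (Symbol T G.NT)) (F : Language (Symbol T G.NT)) : Language T :=
  { x | ∃ y : List (Symbol T G.NT),
      G.Derives [Symbol.nonterminal G.initial] y ∧
      projOn W y ∈ F ∧
      (∀ s ∈ y, s ∈ W ∨ ∃ t, s = Symbol.terminal t) ∧
      x = projT y }

/-- Nonterminals `{S, A, B, X, Y}` of the grammar of STATEMENT 12. -/
inductive NT12 : Type
  | S | A | B | X | Y
deriving DecidableEq

/- The grammar `G` of STATEMENT 12, over an alphabet `α` whose set of consonants is
`C` (the vowels being the complement of `C`); the terminal type is `α ⊕ Fin 3`,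
where `Sum.inr 0`, `Sum.inr 1`, `Sum.inr 2` play the roles of `0`, `1`, `#`.
Rules: `S → A#B`; `B → 0YB`, `B → 0Y`, `B → 1XB`, `B → 1X`;
`A → aAY`, `A → aY` for every vowel `a`; `A → bAX`, `A → bX` for every consonant `b`. -/
open scoped Classical in
noncomputable def grammarG12 (α : Type) [Fintype α] (C : Set α) :
    ContextFreeGrammar (α ⊕ Fin 3) :=
  ⟨NT12, NT12.S,
    ({⟨NT12.S, [Symbol.nonterminal NT12.A, Symbol.terminal (Sum.inr 2),
        Symbol.nonterminal NT12.B]⟩,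
      ⟨NT12.B, [Symbol.terminal (Sum.inr 0), Symbol.nonterminal NT12.Y,
        Symbol.nonterminal NT12.B]⟩,
      ⟨NT12.B, [Symbol.terminal (Sum.inr 0), Symbol.nonterminal NT12.Y]⟩,
      ⟨NT12.B, [Symbol.terminal (Sum.inr 1), Symbol.nonterminal NT12.X,
        Symbol.nonterminal NT12.B]⟩,
      ⟨NT12.B, [Symbol.terminal (Sum.inr 1), Symbol.nonterminal NT12.X]⟩} :
        Finset (ContextFreeRule (α ⊕ Fin 3) NT12)) ∪
    Finset.univ.biUnion (fun a : α =>
      if a ∈ C then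
        {⟨NT12.A, [Symbol.terminal (Sum.inl a), Symbol.nonterminal NT12.A,
            Symbol.nonterminal NT12.X]⟩,
         ⟨NT12.A, [Symbol.terminal (Sum.inl a), Symbol.nonterminal NT12.X]⟩}
      else
        {⟨NT12.A, [Symbol.terminal (Sum.inl a), Symbol.nonterminal NT12.A,
            Symbol.nonterminal NT12.Y]⟩,
         ⟨NT12.A, [Symbol.terminal (Sum.inl a), Symbol.nonterminal NT12.Y]⟩})⟩

namespace NT12

/-- The marker `X` (for a consonant, `true`) or `Y` (for a vowel, `false`). -/
def marker {T : Type*} (b : Bool) : Symbol T NT12 :=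
  Symbol.nonterminal (if b then X else Y)

/-- The terminal `1` (for `true`) or `0` (for `false`). -/
def bit {α : Type*} (b : Bool) : Symbol (α ⊕ Fin 3) NT12 :=
  Symbol.terminal (Sum.inr (if b then 1 else 0))

/-- The string generated from `A` to the left of `#`, with `c` still to be rewritten. -/
def leftForm {α : Type*} (C : Set α) [DecidablePred (· ∈ C)] (u : List α)
    (c : List (Symbol (α ⊕ Fin 3) NT12)) : List (Symbol (α ⊕ Fin 3) NT12) :=
  u.map (fun a => Symbol.terminal (Sum.inl a)) ++ (c ++
    (u.map (fun a => marker (decide (a ∈ C)))).reverse)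

/-- The string generated from `B` to the right of `#`, with `c` still to be rewritten. -/
def rightForm {α : Type*} (v : List Bool)
    (c : List (Symbol (α ⊕ Fin 3) NT12)) : List (Symbol (α ⊕ Fin 3) NT12) :=
  v.flatMap (fun b => [bit b, marker b]) ++ c

end NT12

open NT12

section GrammarG12

variable {α : Type}

/-- The rules of `grammarG12`, with the marker and bit of each rule given by a Boolean. -/
inductive IsRule12 (C : Set α) [DecidablePred (· ∈ C)] :
    ContextFreeRule (α ⊕ Fin 3) NT12 → Prop
  | start : IsRule12 C
      ⟨S, [Symbol.nonterminal A, Symbol.terminal (Sum.inr 2), Symbol.nonterminal B]⟩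
  | right (b : Bool) : IsRule12 C ⟨B, [bit b, marker b, Symbol.nonterminal B]⟩
  | rightEnd (b : Bool) : IsRule12 C ⟨B, [bit b, marker b]⟩
  | left (a : α) : IsRule12 C
      ⟨A, [Symbol.terminal (Sum.inl a), Symbol.nonterminal A, marker (decide (a ∈ C))]⟩
  | leftEnd (a : α) : IsRule12 C
      ⟨A, [Symbol.terminal (Sum.inl a), marker (decide (a ∈ C))]⟩

theorem grammarG12_mem_rules [Fintype α] (C : Set α) [DecidablePred (· ∈ C)]
    (r : ContextFreeRule (α ⊕ Fin 3) NT12) :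
    r ∈ (grammarG12 α C).rules ↔ IsRule12 C r := by
  classical
  refine Finset.mem_union.trans ?_
  simp only [Finset.mem_insert, Finset.mem_singleton, Finset.mem_biUnion, Finset.mem_univ,
    true_and]
  constructor
  · rintro ((rfl | rfl | rfl | rfl | rfl) | ⟨a, h⟩)
    · exact .start
    · exact .right false
    · exact .rightEnd false
    · exact .right true
    · exact .rightEnd true
    · have h1 := IsRule12.left (C := C) a
      have h2 := IsRule12.leftEnd (C := C) a
      by_cases ha : a ∈ C <;> simp only [ha, if_true, if_false, Finset.mem_insert,
        Finset.mem_singleton, marker, decide_true, decide_false, Bool.false_eq_true] at h h1 h2 <;>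
        rcases h with rfl | rfl <;> assumption
  · rintro (_ | b | b | a | a)
    · simp
    · cases b <;> simp [bit, marker]
    · cases b <;> simp [bit, marker]
    all_goals
      refine Or.inr ⟨a, ?_⟩
      by_cases ha : a ∈ C <;> simp [ha, marker]

/-- One derivation step of `grammarG12`. -/
def Step12 (C : Set α) [DecidablePred (· ∈ C)] (y z : List (Symbol (α ⊕ Fin 3) NT12)) : Prop :=
  ∃ r, IsRule12 C r ∧ r.Rewrites y z

theorem grammarG12_derives_iff [Fintype α] (C : Set α) [DecidablePred (· ∈ C)]
    (y z : List (Symbol (α ⊕ Fin 3) NT12)) :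
    (grammarG12 α C).Derives y z ↔ Relation.ReflTransGen (Step12 C) y z := by
  have h (y z : List (Symbol (α ⊕ Fin 3) NT12)) :
      (grammarG12 α C).Produces y z ↔ Step12 C y z :=
    exists_congr fun r => and_congr_left' (grammarG12_mem_rules C r)
  exact ⟨Relation.ReflTransGen.mono (fun y z => (h y z).mp) y z,
    Relation.ReflTransGen.mono (fun y z => (h y z).mpr) y z⟩

theorem IsRule12.step {C : Set α} [DecidablePred (· ∈ C)] {n : NT12}
    {z : List (Symbol (α ⊕ Fin 3) NT12)} (h : IsRule12 C ⟨n, z⟩) :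
    Step12 C [Symbol.nonterminal n] z :=
  ⟨_, h, ContextFreeRule.Rewrites.input_output⟩

theorem Step12.append_left {C : Set α} [DecidablePred (· ∈ C)]
    {y z : List (Symbol (α ⊕ Fin 3) NT12)} (h : Relation.ReflTransGen (Step12 C) y z)
    (p : List (Symbol (α ⊕ Fin 3) NT12)) :
    Relation.ReflTransGen (Step12 C) (p ++ y) (p ++ z) :=
  h.lift (p ++ ·) fun _ _ ⟨r, hr, hrw⟩ => ⟨r, hr, hrw.append_left p⟩

theorem Step12.append_right {C : Set α} [DecidablePred (· ∈ C)]
    {y z : List (Symbol (α ⊕ Fin 3) NT12)} (h : Relation.ReflTransGen (Step12 C) y z)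
    (p : List (Symbol (α ⊕ Fin 3) NT12)) :
    Relation.ReflTransGen (Step12 C) (y ++ p) (z ++ p) :=
  h.lift (· ++ p) fun _ _ ⟨r, hr, hrw⟩ => ⟨r, hr, hrw.append_right p⟩

theorem nonterminal_mem_leftForm {C : Set α} [DecidablePred (· ∈ C)] {u : List α}
    {c : List (Symbol (α ⊕ Fin 3) NT12)} {n : NT12} (hX : n ≠ X) (hY : n ≠ Y) :
    Symbol.nonterminal n ∈ leftForm C u c ↔ Symbol.nonterminal n ∈ c := by
  simp only [leftForm, marker, List.mem_append, List.mem_map, List.mem_reverse]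
  constructor
  · rintro (⟨a, _, h⟩ | h | ⟨a, _, h⟩)
    · simp at h
    · exact h
    · split_ifs at h <;> simp_all
  · exact fun h => Or.inr (Or.inl h)

theorem nonterminal_mem_rightForm {v : List Bool}
    {c : List (Symbol (α ⊕ Fin 3) NT12)} {n : NT12} (hX : n ≠ X) (hY : n ≠ Y) :
    Symbol.nonterminal n ∈ rightForm v c ↔ Symbol.nonterminal n ∈ c := by
  simp only [rightForm, marker, bit, List.mem_append, List.mem_flatMap]
  constructor
  · rintro (⟨a, _, h⟩ | h)
    · cases a <;> simp_all
    · exact h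
  · exact fun h => Or.inr h

/-- The shape of every sentential form other than the start symbol. -/
def IsSententialForm12 (C : Set α) [DecidablePred (· ∈ C)]
    (y : List (Symbol (α ⊕ Fin 3) NT12)) : Prop :=
  ∃ u v c d, (c = [Symbol.nonterminal A] ∨ c = [] ∧ u ≠ []) ∧
    (d = [Symbol.nonterminal B] ∨ d = []) ∧
    y = leftForm C u c ++ Symbol.terminal (Sum.inr 2) :: rightForm v d

theorem IsSententialForm12.rewrites {C : Set α} [DecidablePred (· ∈ C)]
    {y z : List (Symbol (α ⊕ Fin 3) NT12)} (hy : IsSententialForm12 C y)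
    {r : ContextFreeRule (α ⊕ Fin 3) NT12} (hr : IsRule12 C r)
    (h : r.Rewrites y z) : IsSententialForm12 C z := by
  obtain ⟨u, v, c, d, hc, hd, rfl⟩ := hy
  obtain ⟨p, q, hp, rfl⟩ := h.exists_parts
  have hmem : Symbol.nonterminal r.input ∈
      leftForm C u c ++ Symbol.terminal (Sum.inr 2) :: rightForm v d := by
    rw [hp]; simp
  have hA (hi : r.input = A) : c = [Symbol.nonterminal A] ∧
      p = u.map (fun a => Symbol.terminal (Sum.inl a)) ∧
      q = (u.map (fun a => marker (decide (a ∈ C)))).reverse ++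
        Symbol.terminal (Sum.inr 2) :: rightForm v d := by
    rw [hi, List.mem_append, List.mem_cons, nonterminal_mem_leftForm (by simp) (by simp),
      nonterminal_mem_rightForm (by simp) (by simp)] at hmem
    have hc' : c = [Symbol.nonterminal A] := by
      rcases hc with h | h <;> rcases hd with h' | h' <;> simp_all
    refine ⟨hc', ?_⟩
    rw [hi, hc', leftForm] at hp
    have h1 : Symbol.nonterminal A ∉
        u.map (fun a => (Symbol.terminal (Sum.inl a) : Symbol (α ⊕ Fin 3) NT12)) := by simp
    have h2 : Symbol.nonterminal A ∉ (u.map (fun a => marker (decide (a ∈ C)))).reverse ++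
        (Symbol.terminal (Sum.inr 2) : Symbol (α ⊕ Fin 3) NT12) :: rightForm v d := by
      rw [List.mem_append, List.mem_cons, nonterminal_mem_rightForm (by simp) (by simp)]
      have := nonterminal_mem_leftForm (C := C) (u := u) (c := []) (n := A) (by simp) (by simp)
      simp only [leftForm, List.nil_append, List.mem_append] at this
      rcases hd with rfl | rfl <;> simp_all
    have hp' : p ++ Symbol.nonterminal A :: q =
        u.map (fun a => Symbol.terminal (Sum.inl a)) ++ Symbol.nonterminal A ::
          ((u.map (fun a => marker (decide (a ∈ C)))).reverse ++
            Symbol.terminal (Sum.inr 2) :: rightForm v d) := by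
      simpa using hp.symm
    obtain ⟨hl, -, hq⟩ := (List.append_cons_inj_of_notMem h1 h2).mp hp'.symm
    exact ⟨hl.symm, hq.symm⟩
  have hB (hi : r.input = B) : d = [Symbol.nonterminal B] ∧
      p = leftForm C u c ++ Symbol.terminal (Sum.inr 2) :: rightForm v [] ∧ q = [] := by
    rw [hi, List.mem_append, List.mem_cons, nonterminal_mem_leftForm (by simp) (by simp),
      nonterminal_mem_rightForm (by simp) (by simp)] at hmem
    have hd' : d = [Symbol.nonterminal B] := by
      rcases hc with h | h <;> rcases hd with h' | h' <;> simp_all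
    refine ⟨hd', ?_⟩
    have h1 : Symbol.nonterminal B ∉
        leftForm C u c ++ Symbol.terminal (Sum.inr 2) :: rightForm v [] := by
      rw [List.mem_append, List.mem_cons, nonterminal_mem_leftForm (by simp) (by simp),
        nonterminal_mem_rightForm (by simp) (by simp)]
      rcases hc with h | h <;> simp_all
    rw [hi, hd'] at hp
    have hp' : (leftForm C u c ++ Symbol.terminal (Sum.inr 2) :: rightForm v []) ++
        [Symbol.nonterminal B] = p ++ Symbol.nonterminal B :: q := by
      simpa [rightForm] using hp
    obtain ⟨hl, -, hq⟩ := (List.append_cons_inj_of_notMem h1 List.not_mem_nil).mp hp'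
    exact ⟨hl.symm, hq.symm⟩
  rcases hr with _ | b | b | a | a
  · rw [List.mem_append, List.mem_cons, nonterminal_mem_leftForm (by simp) (by simp),
      nonterminal_mem_rightForm (by simp) (by simp)] at hmem
    rcases hc with h | h <;> rcases hd with h' | h' <;> simp_all
  · obtain ⟨rfl, rfl, rfl⟩ := hB rfl
    exact ⟨u, v ++ [b], c, [Symbol.nonterminal B], hc, Or.inl rfl, by simp [rightForm]⟩
  · obtain ⟨rfl, rfl, rfl⟩ := hB rfl
    exact ⟨u, v ++ [b], c, [], hc, Or.inr rfl, by simp [rightForm]⟩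
  · obtain ⟨rfl, rfl, rfl⟩ := hA rfl
    exact ⟨u ++ [a], v, [Symbol.nonterminal A], d, Or.inl rfl, hd, by simp [leftForm]⟩
  · obtain ⟨rfl, rfl, rfl⟩ := hA rfl
    exact ⟨u ++ [a], v, [], d, Or.inr ⟨rfl, by simp⟩, hd, by simp [leftForm]⟩

theorem isSententialForm12_of_initial {C : Set α} [DecidablePred (· ∈ C)]
    {y : List (Symbol (α ⊕ Fin 3) NT12)}
    (h : Relation.ReflTransGen (Step12 C) [Symbol.nonterminal S] y) :
    y = [Symbol.nonterminal S] ∨ IsSententialForm12 C y := by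
  induction h with
  | refl => exact Or.inl rfl
  | tail _ hstep ih =>
    obtain ⟨r, hr, hrw⟩ := hstep
    right
    rcases ih with rfl | ih
    · obtain ⟨p, q, hp, rfl⟩ := hrw.exists_parts
      have hp' : p = [] ∧ q = [] ∧ r.input = S := by
        cases p <;> simp_all
      obtain ⟨rfl, rfl, hS⟩ := hp'
      rcases hr with _ | b | b | a | a
      · exact ⟨[], [], [Symbol.nonterminal A], [Symbol.nonterminal B], Or.inl rfl, Or.inl rfl,
          by simp [leftForm, rightForm]⟩
      all_goals simp at hS
    · exact ih.rewrites hr hrw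

theorem derives_leftForm (C : Set α) [DecidablePred (· ∈ C)] {u : List α} (hu : u ≠ []) :
    Relation.ReflTransGen (Step12 C) [Symbol.nonterminal A] (leftForm C u []) := by
  induction u with
  | nil => exact absurd rfl hu
  | cons a u ih =>
    by_cases h : u = []
    · subst h
      exact .single (IsRule12.leftEnd a).step
    · refine .head (IsRule12.left a).step ?_
      simpa [leftForm] using Step12.append_right
        (Step12.append_left (ih h) [Symbol.terminal (Sum.inl a)]) [marker (decide (a ∈ C))]

theorem derives_rightForm (C : Set α) [DecidablePred (· ∈ C)] {v : List Bool} (hv : v ≠ []) :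
    Relation.ReflTransGen (Step12 C) [Symbol.nonterminal B] (rightForm v []) := by
  induction v with
  | nil => exact absurd rfl hv
  | cons b v ih =>
    by_cases h : v = []
    · subst h
      exact .single (IsRule12.rightEnd b).step
    · refine .head (IsRule12.right b).step ?_
      simpa [rightForm] using Step12.append_left (ih h) [bit b, marker b]

theorem derives_closed (C : Set α) [DecidablePred (· ∈ C)]
    {u : List α} {v : List Bool} (hu : u ≠ []) (hv : v ≠ []) :
    Relation.ReflTransGen (Step12 C) [Symbol.nonterminal S]
      (leftForm C u [] ++ Symbol.terminal (Sum.inr 2) :: rightForm v []) := by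
  refine .head IsRule12.start.step ?_
  refine (Step12.append_right (derives_leftForm C hu)
    [Symbol.terminal (Sum.inr 2), Symbol.nonterminal B]).trans ?_
  exact Step12.append_left
    (Step12.append_left (derives_rightForm C hv) [Symbol.terminal (Sum.inr 2)]) (leftForm C u [])

theorem projOn_closed (C : Set α) [DecidablePred (· ∈ C)] (u : List α) (v : List Bool) :
    projOn ({Symbol.nonterminal X, Symbol.nonterminal Y, Symbol.terminal (Sum.inr 2)} :
        Set (Symbol (α ⊕ Fin 3) NT12))
      (leftForm C u [] ++ Symbol.terminal (Sum.inr 2) :: rightForm v []) =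
    (u.map (fun a => marker (decide (a ∈ C)))).reverse ++
      Symbol.terminal (Sum.inr 2) :: v.map marker := by
  have hu : ∀ u : List α, projOn ({Symbol.nonterminal X, Symbol.nonterminal Y,
      Symbol.terminal (Sum.inr 2)} : Set (Symbol (α ⊕ Fin 3) NT12))
      (u.map (fun a => Symbol.terminal (Sum.inl a))) = [] := by
    intro u; simp [projOn]
  have hm : ∀ v : List Bool, projOn ({Symbol.nonterminal X, Symbol.nonterminal Y,
      Symbol.terminal (Sum.inr 2)} : Set (Symbol (α ⊕ Fin 3) NT12)) (v.map marker) =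
      v.map marker := by
    intro v
    simp only [projOn, List.filter_eq_self, List.mem_map]
    rintro _ ⟨b, _, rfl⟩
    cases b <;> simp [marker]
  have hr : ∀ v : List Bool, projOn ({Symbol.nonterminal X, Symbol.nonterminal Y,
      Symbol.terminal (Sum.inr 2)} : Set (Symbol (α ⊕ Fin 3) NT12)) (rightForm v []) =
      v.map marker := by
    intro v
    induction v with
    | nil => simp [projOn, rightForm]
    | cons b v ih =>
      simp only [projOn, rightForm] at ih ⊢
      cases b <;> simp_all [marker, bit]
  have hm' := hm (u.map (fun a => decide (a ∈ C))).reverse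
  have hu' := hu u
  have hr' := hr v
  simp only [projOn, List.map_reverse, List.map_map, Function.comp_def] at hm' hu' hr' ⊢
  simp only [leftForm, List.filter_append, List.nil_append, hm', hu']
  rw [List.filter_cons_of_pos (by simp), hr']

theorem projT_closed (C : Set α) [DecidablePred (· ∈ C)] (u : List α) (v : List Bool) :
    projT (leftForm C u [] ++ Symbol.terminal (Sum.inr 2) :: rightForm v []) =
    u.map Sum.inl ++ Sum.inr 2 :: v.map (fun b => Sum.inr (if b then 1 else 0)) := by
  have hr : projT (rightForm v [] : List (Symbol (α ⊕ Fin 3) NT12)) =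
      v.map (fun b => Sum.inr (if b then 1 else 0)) := by
    induction v with
    | nil => simp [projT, rightForm]
    | cons b v ih => simp_all [projT, rightForm, marker, bit]
  have hm : projT (u.map (fun a => marker (decide (a ∈ C)))).reverse = ([] : List (α ⊕ Fin 3)) := by
    simp [projT, marker]
  have hu : projT (u.map (fun a => (Symbol.terminal (Sum.inl a) : Symbol (α ⊕ Fin 3) NT12))) =
      u.map Sum.inl := by
    induction u <;> simp_all [projT]
  simp only [projT, leftForm, List.filterMap_append, List.nil_append, List.filterMap_cons] at *
  simp [hr, hm, hu]

theorem marker_injective {T : Type*} : Function.Injective (marker : Bool → Symbol T NT12) := by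
  intro a b
  cases a <;> cases b <;> simp [marker]

theorem not_marker_or_terminal {n : NT12} (hX : n ≠ X) (hY : n ≠ Y) :
    ¬((Symbol.nonterminal n : Symbol (α ⊕ Fin 3) NT12) ∈ ({Symbol.nonterminal X,
        Symbol.nonterminal Y, Symbol.terminal (Sum.inr 2)} : Set (Symbol (α ⊕ Fin 3) NT12)) ∨
      ∃ t, (Symbol.nonterminal n : Symbol (α ⊕ Fin 3) NT12) = Symbol.terminal t) := by
  simp [hX, hY]

theorem mem_markers_or_terminal_of_mem_closed {C : Set α} [DecidablePred (· ∈ C)] {u : List α}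
    {v : List Bool} {s : Symbol (α ⊕ Fin 3) NT12}
    (hs : s ∈ leftForm C u [] ++ Symbol.terminal (Sum.inr 2) :: rightForm v []) :
    s ∈ ({Symbol.nonterminal X, Symbol.nonterminal Y, Symbol.terminal (Sum.inr 2)} :
        Set (Symbol (α ⊕ Fin 3) NT12)) ∨ ∃ t, s = Symbol.terminal t := by
  cases s with
  | terminal t => exact Or.inr ⟨t, rfl⟩
  | nonterminal n =>
    by_contra hn
    have hX : n ≠ X := by rintro rfl; simp at hn
    have hY : n ≠ Y := by rintro rfl; simp at hn
    rw [List.mem_append, List.mem_cons, nonterminal_mem_leftForm hX hY,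
      nonterminal_mem_rightForm hX hY] at hs
    simp at hs

end GrammarG12

/-- With `W = {X, Y, #}` and `F = {w#w^R : w ∈ {X,Y}*}`,
`L(G,F) = {w#σ(w) : w ∈ α⁺}`, where `σ` maps every consonant to `1` and every
vowel to `0`. -/
theorem grammarG12_finalized (α : Type) [Fintype α] (C : Set α)
    [DecidablePred (· ∈ C)] :
    finalizedLanguage (grammarG12 α C)
      ({Symbol.nonterminal NT12.X, Symbol.nonterminal NT12.Y,
        Symbol.terminal (Sum.inr 2)} : Set (Symbol (α ⊕ Fin 3) NT12))
      { x | ∃ w : List (Symbol (α ⊕ Fin 3) NT12),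
          (∀ s ∈ w, s = Symbol.nonterminal NT12.X ∨ s = Symbol.nonterminal NT12.Y) ∧
          x = w ++ Symbol.terminal (Sum.inr 2) :: w.reverse } =
    { x | ∃ w : List α, w ≠ [] ∧
        x = w.map Sum.inl ++ (Sum.inr 2 : α ⊕ Fin 3) ::
          w.map (fun a => (Sum.inr (if a ∈ C then 1 else 0) : α ⊕ Fin 3)) } := by
  ext x
  constructor
  · rintro ⟨y, hy, ⟨w, hw, hF⟩, hW, rfl⟩
    rcases isSententialForm12_of_initial
        ((grammarG12_derives_iff C _ _).mp hy) with rfl | ⟨u, v, c, d, hc, hd, rfl⟩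
    · exact not_marker_or_terminal (by simp) (by simp) (hW (Symbol.nonterminal S) (List.mem_singleton_self _)) |>.elim
    · have hc' : c = [] ∧ u ≠ [] := by
        refine hc.resolve_left ?_
        rintro rfl
        exact not_marker_or_terminal (by simp) (by simp) (hW (Symbol.nonterminal A) (List.mem_append_left _
          ((nonterminal_mem_leftForm (by simp) (by simp)).mpr (List.mem_singleton_self _))))
      have hd' : d = [] := by
        refine hd.resolve_left ?_
        rintro rfl
        exact not_marker_or_terminal (by simp) (by simp) (hW (Symbol.nonterminal B) (List.mem_append_right _ (List.mem_cons_of_mem _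
          ((nonterminal_mem_rightForm (by simp) (by simp)).mpr (List.mem_singleton_self _)))))
      obtain ⟨rfl, hu⟩ := hc'
      subst hd'
      replace hF := (projOn_closed C u v).symm.trans hF
      have hnot : (Symbol.terminal (Sum.inr 2) : Symbol (α ⊕ Fin 3) NT12) ∉ w := by
        intro h
        simpa using hw _ h
      obtain ⟨rfl, -, hv⟩ := (List.append_cons_inj_of_notMem hnot (by simpa using hnot)).mp hF.symm
      have hv' : v = u.map (fun a => decide (a ∈ C)) := by
        apply List.map_injective_iff.mpr marker_injective
        rw [← hv]
        simp
      refine ⟨u, hu, ?_⟩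
      refine (projT_closed C u v).trans ?_
      rw [hv']
      simp
  · rintro ⟨u, hu, rfl⟩
    refine ⟨_, (grammarG12_derives_iff C _ _).mpr
        (derives_closed C (v := u.map (fun a => decide (a ∈ C))) hu (by simpa)),
      ⟨(u.map (fun a => marker (decide (a ∈ C)))).reverse, ?_, ?_⟩,
      fun s hs => mem_markers_or_terminal_of_mem_closed hs, ?_⟩
    · simp only [List.mem_reverse, List.mem_map]
      rintro _ ⟨a, _, rfl⟩
      by_cases h : a ∈ C <;> simp [marker, h]
    · refine (projOn_closed C u _).trans ?_
      simp
    · refine Eq.trans ?_ (projT_closed C u _).symm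
      simp
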